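/- arXiv:1312.4009 — 8 statements merged into one kernel-verified Lean document; each statement's English description precedes it below -/
import Mathlib

section
/- The number of knot (4,4)-mosaics is D_{4,4} = 2594. -/
/-- The eleven mosaic tiles `T₀, …, T₁₀`. -/
inductive Tile : Type
  | T0 | T1 | T2 | T3 | T4 | T5 | T6 | T7 | T8 | T9 | T10
  deriving DecidableEq

namespace Tile

/-- Whether the top edge of a tile carries a connection point.
`T0` has no connection points; `T1,…,T6` realize the six unordered pairs of edges
(`T1`: bottom–left, `T2`: bottom–right, `T3`: top–right, `T4`: top–left,
`T5`: left–right, `T6`: top–bottom); `T7,…,T10` have all four. -/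
def top : Tile → Bool
  | .T3 | .T4 | .T6 | .T7 | .T8 | .T9 | .T10 => true
  | _ => false

/-- Whether the bottom edge of a tile carries a connection point. -/
def bottom : Tile → Bool
  | .T1 | .T2 | .T6 | .T7 | .T8 | .T9 | .T10 => true
  | _ => false

/-- Whether the left edge of a tile carries a connection point. -/
def left : Tile → Bool
  | .T1 | .T4 | .T5 | .T7 | .T8 | .T9 | .T10 => true
  | _ => false

/-- Whether the right edge of a tile carries a connection point. -/
def right : Tile → Bool
  | .T2 | .T3 | .T5 | .T7 | .T8 | .T9 | .T10 => true
  | _ => false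

end Tile

/-- An `(m,n)`-mosaic `M : Fin m → Fin n → Tile` (rows indexed top-to-bottom,
columns left-to-right) is suitably connected if any pair of contiguous tiles
have or do not have connection points simultaneously on their common edge. -/
def SuitablyConnected {m n : ℕ} (M : Fin m → Fin n → Tile) : Prop :=
  (∀ (i : Fin m) (j : Fin n) (h : (j : ℕ) + 1 < n),
    (M i j).right = (M i ⟨(j : ℕ) + 1, h⟩).left) ∧
  (∀ (i : Fin m) (j : Fin n) (h : (i : ℕ) + 1 < m),
    (M i j).bottom = (M ⟨(i : ℕ) + 1, h⟩ j).top)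

/-- None of the boundary edges of the mosaic carries a connection point. -/
def BoundaryFree {m n : ℕ} (M : Fin m → Fin n → Tile) : Prop :=
  ∀ (i : Fin m) (j : Fin n),
    ((i : ℕ) = 0 → (M i j).top = false) ∧
    ((i : ℕ) = m - 1 → (M i j).bottom = false) ∧
    ((j : ℕ) = 0 → (M i j).left = false) ∧
    ((j : ℕ) = n - 1 → (M i j).right = false)

/-- A knot `(m,n)`-mosaic is a suitably connected mosaic none of whose boundary
edges has a connection point. -/
def IsKnotMosaic {m n : ℕ} (M : Fin m → Fin n → Tile) : Prop :=
  SuitablyConnected M ∧ BoundaryFree M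

/-- `D m n`, the number of knot `(m,n)`-mosaics. -/
noncomputable def knotMosaicCount (m n : ℕ) : ℕ :=
  Nat.card {M : Fin m → Fin n → Tile // IsKnotMosaic M}

/-- `|Q^{(p,q)}|`, the number of `(p,q)`-quasimosaics (suitably connected
`(p,q)`-mosaics, with connection points allowed on boundary edges). -/
noncomputable def quasimosaicCount (p q : ℕ) : ℕ :=
  Nat.card {M : Fin p → Fin q → Tile // SuitablyConnected M}

section Paths

variable {α β : Type*}

/-- `f` lists the consecutive edges of a path from `x` to `y`, where the edge `a` runs from
`src a` to `tgt a`. -/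
def IsPath (src tgt : α → β) : {n : ℕ} → β → β → (Fin n → α) → Prop
  | 0, x, y, _ => x = y
  | _ + 1, x, y, f => src (f 0) = x ∧ IsPath src tgt (tgt (f 0)) y (Fin.tail f)

theorem isPath_iff (src tgt : α → β) {n : ℕ} (x y : β) (f : Fin n → α) :
    IsPath src tgt x y f ↔ (n = 0 → x = y) ∧
      (∀ j : Fin n, (j : ℕ) = 0 → src (f j) = x) ∧
      (∀ j : Fin n, (j : ℕ) = n - 1 → tgt (f j) = y) ∧
      ∀ (j : Fin n) (h : (j : ℕ) + 1 < n), tgt (f j) = src (f ⟨(j : ℕ) + 1, h⟩) := by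
  induction n generalizing x with
  | zero => simp [IsPath]
  | succ n ih =>
    rw [IsPath, ih]
    rcases n with _ | n
    · constructor
      · rintro ⟨hs, ht, -⟩
        refine ⟨by simp, fun j _ => ?_, fun j _ => ?_, fun j hj => by omega⟩
        · rwa [Fin.fin_one_eq_zero j]
        · rw [Fin.fin_one_eq_zero j]
          exact ht rfl
      · rintro ⟨-, hs, ht, -⟩
        exact ⟨hs 0 rfl, fun _ => ht 0 rfl, fun j => j.elim0, fun j => j.elim0,
          fun j => j.elim0⟩
    · simp only [Fin.tail]
      constructor
      · rintro ⟨hx, -, hs, ht, hc⟩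
        refine ⟨by simp, fun j hj => ?_, fun j hj => ?_, fun j hj => ?_⟩
        · rwa [show j = 0 from Fin.ext hj]
        · cases j using Fin.cases with
          | zero => simp at hj
          | succ j => exact ht j (by simpa using hj)
        · cases j using Fin.cases with
          | zero => exact (hs 0 rfl).symm
          | succ j => exact hc j (by simpa using hj)
      · rintro ⟨-, hs, ht, hc⟩
        refine ⟨hs 0 rfl, by simp, fun j hj => ?_, fun j hj => ?_, fun j hj => ?_⟩
        · rw [show j = 0 from Fin.ext hj]
          exact (hc 0 (by simp)).symm
        · exact ht j.succ (by simp [hj])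
        · exact hc j.succ (by simpa using hj)

/-- Splitting a path into its first edge and the remaining path. -/
def isPathSuccEquiv (src tgt : α → β) {n : ℕ} (P : Fin (n + 1) → α → Prop) (x y : β) :
    {f : Fin (n + 1) → α // IsPath src tgt x y f ∧ ∀ i, P i (f i)} ≃
      Σ z : β, {a : α // (src a = x ∧ tgt a = z) ∧ P 0 a} ×
        {f : Fin n → α // IsPath src tgt z y f ∧ ∀ i, P i.succ (f i)} where
  toFun f := ⟨tgt (f.1 0), ⟨f.1 0, ⟨f.2.1.1, rfl⟩, f.2.2 0⟩,
    ⟨Fin.tail f.1, f.2.1.2, fun i => f.2.2 i.succ⟩⟩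
  invFun p := ⟨Fin.cons p.2.1.1 p.2.2.1, by
    obtain ⟨z, ⟨a, ⟨hs, rfl⟩, hP⟩, f, hf, hfP⟩ := p
    exact ⟨⟨hs, hf⟩, Fin.cases hP hfP⟩⟩
  left_inv f := Subtype.ext (Fin.cons_self_tail f.1)
  right_inv p := by
    obtain ⟨z, ⟨a, ⟨hs, rfl⟩, hP⟩, f, hf, hfP⟩ := p
    rfl

/-- The transfer matrix method, with a possibly different set of allowed edges at each step. -/
theorem card_isPath_eq_prod [Finite α] [Fintype β] [DecidableEq β] (src tgt : α → β) {n : ℕ}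
    (P : Fin n → α → Prop) (x y : β) :
    Nat.card {f : Fin n → α // IsPath src tgt x y f ∧ ∀ i, P i (f i)} =
      (List.ofFn fun i => (Matrix.of fun u v =>
        Nat.card {a : α // (src a = u ∧ tgt a = v) ∧ P i a} : Matrix β β ℕ)).prod x y := by
  induction n generalizing x with
  | zero => by_cases h : x = y <;> simp [IsPath, h]
  | succ n ih =>
    rw [Nat.card_congr (isPathSuccEquiv src tgt P x y), Nat.card_sigma]
    simp only [Nat.card_prod, ih, List.ofFn_succ, List.prod_cons, Matrix.mul_apply,
      Matrix.of_apply]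

end Paths

instance : Fintype Tile where
  elems := {.T0, .T1, .T2, .T3, .T4, .T5, .T6, .T7, .T8, .T9, .T10}
  complete t := by cases t <;> decide

theorem isKnotMosaic_iff {m n : ℕ} (M : Fin m → Fin n → Tile) :
    IsKnotMosaic M ↔
      IsPath (fun r j => (r j).top) (fun r j => (r j).bottom)
        (fun _ => false) (fun _ => false) M ∧
      ∀ i, IsPath Tile.left Tile.right false false (M i) := by
  simp only [isPath_iff, IsKnotMosaic, SuitablyConnected, BoundaryFree, funext_iff]
  grind

/-- The number of tiles with prescribed connection points. -/
def tileCount (t b l r : Bool) : ℕ :=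
  if (t ^^ b) = (l ^^ r) then if t && b && l && r then 4 else 1 else 0

theorem card_tile (t b l r : Bool) :
    Nat.card {a : Tile // (a.left = l ∧ a.right = r) ∧ a.top = t ∧ a.bottom = b} =
      tileCount t b l r := by
  rw [Nat.card_eq_fintype_card]
  revert t b l r
  decide

/-- The matrix counting the rows of a mosaic, closed on the left and on the right, with prescribed
connection points on their top and bottom edges. -/
def rowMatrix (n : ℕ) : Matrix (Fin n → Bool) (Fin n → Bool) ℕ :=
  Matrix.of fun t b =>
    (List.ofFn fun i => (Matrix.of (tileCount (t i) (b i)) : Matrix Bool Bool ℕ)).prod false false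

theorem card_row {n : ℕ} (t b : Fin n → Bool) :
    Nat.card {r : Fin n → Tile // ((fun j => (r j).top) = t ∧ (fun j => (r j).bottom) = b) ∧
      IsPath Tile.left Tile.right false false r} = rowMatrix n t b := by
  have h := card_isPath_eq_prod Tile.left Tile.right
    (fun i a => a.top = t i ∧ a.bottom = b i) false false
  simp only [card_tile] at h
  refine Eq.trans (Nat.card_congr (Equiv.subtypeEquivRight fun r => ?_)) h
  simp only [funext_iff, forall_and]
  tauto

theorem knotMosaicCount_eq_rowMatrix_pow (m n : ℕ) :
    knotMosaicCount m n = (rowMatrix n ^ m) (fun _ => false) (fun _ => false) := by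
  have h := card_isPath_eq_prod (n := m) (fun (r : Fin n → Tile) j => (r j).top)
    (fun r j => (r j).bottom) (fun _ r => IsPath Tile.left Tile.right false false r)
    (fun _ => false) (fun _ => false)
  simp only [card_row, List.ofFn_const, List.prod_replicate] at h
  rw [knotMosaicCount, Nat.card_congr (Equiv.subtypeEquivRight isKnotMosaic_iff)]
  exact h

/-- The number of knot `(4,4)`-mosaics is `D_{4,4} = 2594`. -/
theorem knotMosaicCount_four_four : knotMosaicCount 4 4 = 2594 := by
  rw [knotMosaicCount_eq_rowMatrix_pow, pow_add _ 2 2, pow_two,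
    Matrix.mul_apply]
  simp only [Matrix.mul_apply]
  decide +kernel
end

section
/- The number of knot (5,5)-mosaics is D_{5,5} = 4183954. -/
namespace Tile

instance : Fintype Tile where
  elems := {.T0, .T1, .T2, .T3, .T4, .T5, .T6, .T7, .T8, .T9, .T10}
  complete := by rintro ⟨⟩ <;> decide

/-- The number of tiles with prescribed connection points. -/
def weight (t b l r : Bool) : ℕ :=
  if (t ^^ b ^^ l ^^ r) then 0 else if t && b && l && r then 4 else 1

theorem card_eq_weight (t b l r : Bool) :
    Nat.card {x : Tile // (x.top = t ∧ x.bottom = b) ∧ x.left = l ∧ x.right = r} =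
      weight t b l r := by
  rw [Nat.card_eq_fintype_card]
  revert t b l r
  decide

end Tile

section Walks

variable {S T : Type*} (src dst : T → S)

/-- `f` is a walk from `a` to `b`, where each `t : T` is regarded as an arrow `src t ⟶ dst t`. -/
def IsWalk (b : S) : (n : ℕ) → S → (Fin n → T) → Prop
  | 0, a, _ => a = b
  | n + 1, a, f => src (f 0) = a ∧ IsWalk b n (dst (f 0)) (Fin.tail f)

theorem isWalk_succ_iff (b : S) (n : ℕ) (a : S) (f : Fin (n + 1) → T) :
    IsWalk src dst b (n + 1) a f ↔
      (∀ (i : Fin (n + 1)) (h : (i : ℕ) + 1 < n + 1), dst (f i) = src (f ⟨i + 1, h⟩)) ∧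
        src (f 0) = a ∧ dst (f (Fin.last n)) = b := by
  induction n generalizing a with
  | zero =>
    exact ⟨fun h => ⟨fun i hi => absurd hi (by omega), h⟩, fun h => h.2⟩
  | succ n ih =>
    rw [IsWalk, ih, Fin.forall_fin_succ (n := n + 1)]
    simp only [Fin.tail, Fin.val_zero, Fin.val_succ, Fin.succ_last, Fin.succ_mk]
    constructor
    · rintro ⟨ha, h, h0, hb⟩
      exact ⟨⟨fun _ => h0.symm, fun i hi => h i (by omega)⟩, ha, hb⟩
    · rintro ⟨⟨h0, h⟩, ha, hb⟩
      exact ⟨ha, fun i hi => h i (by omega), (h0 (by omega)).symm, hb⟩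

theorem card_isWalk_zero [DecidableEq S] (a b : S) (P : Fin 0 → T → Prop) :
    Nat.card {f : Fin 0 → T // (∀ i, P i (f i)) ∧ IsWalk src dst b 0 a f} =
      if a = b then 1 else 0 := by
  split_ifs with h <;> simp [IsWalk, h]

theorem card_isWalk_succ [Fintype S] [Finite T] (b : S) (n : ℕ) (a : S)
    (P : Fin (n + 1) → T → Prop) :
    Nat.card {f : Fin (n + 1) → T // (∀ i, P i (f i)) ∧ IsWalk src dst b (n + 1) a f} =
      ∑ s, Nat.card {t : T // P 0 t ∧ src t = a ∧ dst t = s} *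
        Nat.card {f : Fin n → T // (∀ i, P i.succ (f i)) ∧ IsWalk src dst b n s f} := by
  simp_rw [← Nat.card_prod]
  rw [← Nat.card_sigma]
  refine Nat.card_congr
    { toFun := fun f => ⟨dst (f.1 0), ⟨f.1 0, f.2.1 0, f.2.2.1, rfl⟩,
        ⟨Fin.tail f.1, fun i => f.2.1 i.succ, f.2.2.2⟩⟩
      invFun := fun x => ⟨Fin.cons x.2.1.1 x.2.2.1, ?_, ?_⟩
      left_inv := ?_
      right_inv := ?_ }
  · obtain ⟨s, ⟨t, ht⟩, ⟨g, hg⟩⟩ := x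
    exact Fin.cases ht.1 hg.1
  · obtain ⟨s, ⟨t, ht, hs, rfl⟩, ⟨g, hg⟩⟩ := x
    exact ⟨hs, hg.2⟩
  · rintro ⟨f, hf⟩
    exact Subtype.ext (Fin.cons_self_tail f)
  · rintro ⟨s, ⟨t, ht, hs, rfl⟩, ⟨g, hg⟩⟩
    rfl

end Walks

/-- The number of rows of tiles with tops `u`, bottoms `v`, leftmost connection `l` and no
connection point on the right boundary. -/
def rowCount : (n : ℕ) → (Fin n → Bool) → (Fin n → Bool) → Bool → ℕ
  | 0, _, _, l => if l = false then 1 else 0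
  | n + 1, u, v, l =>
    (Tile.weight (u 0) (v 0) l true * rowCount n (Fin.tail u) (Fin.tail v) true) +
      Tile.weight (u 0) (v 0) l false * rowCount n (Fin.tail u) (Fin.tail v) false

theorem card_row_eq_rowCount (n : ℕ) (u v : Fin n → Bool) (l : Bool) :
    Nat.card {f : Fin n → Tile // (∀ i, (f i).top = u i ∧ (f i).bottom = v i) ∧
      IsWalk Tile.left Tile.right false n l f} = rowCount n u v l := by
  induction n generalizing l with
  | zero =>
    exact card_isWalk_zero _ _ _ _ fun i (t : Tile) => t.top = u i ∧ t.bottom = v i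
  | succ n ih =>
    rw [card_isWalk_succ _ _ _ _ _ fun i (t : Tile) => t.top = u i ∧ t.bottom = v i,
      Fintype.sum_bool]
    simp_rw [Tile.card_eq_weight]
    exact congrArg₂ _ (congrArg _ (ih (Fin.tail u) (Fin.tail v) true))
      (congrArg _ (ih (Fin.tail u) (Fin.tail v) false))

/-- The number of `m`-row mosaics of width `n` with tops `u` and no other connection
points on the boundary. -/
def mosaicCount (n : ℕ) : ℕ → (Fin n → Bool) → ℕ
  | 0, u => if u = fun _ => false then 1 else 0
  | m + 1, u => ∑ v, rowCount n u v false * mosaicCount n m v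

theorem card_mosaic_eq_mosaicCount (n m : ℕ) (u : Fin n → Bool) :
    Nat.card {f : Fin m → Fin n → Tile //
      (∀ i, IsWalk Tile.left Tile.right false n false (f i)) ∧
        IsWalk (fun r j => (r j).top) (fun r j => (r j).bottom) (fun _ => false) m u f} =
      mosaicCount n m u := by
  induction m generalizing u with
  | zero =>
    exact card_isWalk_zero _ _ _ _ fun _ r => IsWalk Tile.left Tile.right false n false r
  | succ m ih =>
    rw [card_isWalk_succ _ _ _ _ _ fun _ r => IsWalk Tile.left Tile.right false n false r,
      mosaicCount]
    refine Finset.sum_congr rfl fun v _ => congrArg₂ _ ?_ (ih v)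
    rw [← card_row_eq_rowCount]
    refine Nat.card_congr (Equiv.subtypeEquivRight fun r => ?_)
    rw [funext_iff, funext_iff, forall_and, and_comm]

theorem isKnotMosaic_succ_iff (m n : ℕ) (M : Fin (m + 1) → Fin (n + 1) → Tile) :
    IsKnotMosaic M ↔
      (∀ i, IsWalk Tile.left Tile.right false (n + 1) false (M i)) ∧
        IsWalk (fun r j => (r j).top) (fun r j => (r j).bottom) (fun _ => false) (m + 1)
          (fun _ => false) M := by
  simp only [isWalk_succ_iff, funext_iff]
  constructor
  · rintro ⟨⟨hr, hb⟩, h⟩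
    exact ⟨fun i => ⟨hr i, (h i 0).2.2.1 rfl, (h i (Fin.last n)).2.2.2 rfl⟩,
      fun i hi j => hb i j hi, fun j => (h 0 j).1 rfl, fun j => (h (Fin.last m) j).2.1 rfl⟩
  · rintro ⟨hrow, hcol, htop, hbot⟩
    refine ⟨⟨fun i => (hrow i).1, fun i j hi => hcol i hi j⟩, fun i j => ⟨?_, ?_, ?_, ?_⟩⟩ <;>
      intro h
    · obtain rfl : i = 0 := Fin.ext h
      exact htop j
    · obtain rfl : i = Fin.last m := Fin.ext h
      exact hbot j
    · obtain rfl : j = 0 := Fin.ext h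
      exact (hrow i).2.1
    · obtain rfl : j = Fin.last n := Fin.ext h
      exact (hrow i).2.2

theorem knotMosaicCount_succ (m n : ℕ) :
    knotMosaicCount (m + 1) (n + 1) = mosaicCount (n + 1) (m + 1) fun _ => false := by
  rw [← card_mosaic_eq_mosaicCount]
  exact Nat.card_congr (Equiv.subtypeEquivRight (isKnotMosaic_succ_iff m n))

/-- The list of values of a function on Boolean vectors, in lexicographic order. -/
def boolTable : (n : ℕ) → ((Fin n → Bool) → ℕ) → List ℕ
  | 0, F => [F Fin.elim0]
  | n + 1, F => boolTable n (fun v => F (Fin.cons true v)) ++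
      boolTable n fun v => F (Fin.cons false v)

theorem length_boolTable (n : ℕ) (F : (Fin n → Bool) → ℕ) : (boolTable n F).length = 2 ^ n := by
  induction n with
  | zero => rfl
  | succ n ih => rw [boolTable, List.length_append, ih, ih, pow_succ, mul_two]

theorem sum_zipWith_boolTable (n : ℕ) (F G : (Fin n → Bool) → ℕ) :
    (List.zipWith (· * ·) (boolTable n F) (boolTable n G)).sum = ∑ v, F v * G v := by
  induction n with
  | zero =>
    simp only [boolTable, Fintype.sum_unique, List.zipWith_cons_cons, List.zipWith_nil_left,
      List.sum_singleton]
    congr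
  | succ n ih =>
    rw [boolTable, boolTable, List.zipWith_append (by simp only [length_boolTable]),
      List.sum_append, ih, ih, ← (Fin.consEquiv fun _ => Bool).sum_comp, Fintype.sum_prod_type,
      Fintype.sum_bool]
    rfl

/-- The table of values of `mosaicCount n m`. -/
def mosaicTable (n : ℕ) : ℕ → List ℕ
  | 0 => boolTable n fun u => if u = fun _ => false then 1 else 0
  | m + 1 => boolTable n fun u =>
      (List.zipWith (· * ·) (boolTable n fun v => rowCount n u v false) (mosaicTable n m)).sum

theorem mosaicTable_eq (n m : ℕ) : mosaicTable n m = boolTable n (mosaicCount n m) := by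
  induction m with
  | zero => rfl
  | succ m ih => simp_rw [mosaicTable, ih, sum_zipWith_boolTable]; rfl

theorem mosaicCount_succ (n m : ℕ) (u : Fin n → Bool) :
    mosaicCount n (m + 1) u =
      (List.zipWith (· * ·) (boolTable n fun v => rowCount n u v false) (mosaicTable n m)).sum := by
  rw [mosaicTable_eq, sum_zipWith_boolTable, mosaicCount]

/-- The number of knot `(5,5)`-mosaics is `D_{5,5} = 4183954`. -/
theorem knotMosaicCount_five_five : knotMosaicCount 5 5 = 4183954 := by
  rw [knotMosaicCount_succ, mosaicCount_succ]
  decide +kernel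
end

section
/- For every integer n ≥ 2, the number of knot (2,n)-mosaics is D_{2,n} = 2^{n-1}. -/
namespace Tile

/-- The tile with no connection point on top and prescribed left and right connection points. -/
def ofTopFree : Bool → Bool → Tile
  | false, false => .T0
  | false, true => .T2
  | true, false => .T1
  | true, true => .T5

/-- The tile with no connection point at the bottom and prescribed left and right connection
points. -/
def ofBottomFree : Bool → Bool → Tile
  | false, false => .T0
  | false, true => .T3
  | true, false => .T4
  | true, true => .T5

theorem eq_ofTopFree {t : Tile} (h : t.top = false) : t = ofTopFree t.left t.right := by
  cases t <;> simp_all [top, left, right, ofTopFree]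

theorem eq_ofBottomFree {t : Tile} (h : t.bottom = false) : t = ofBottomFree t.left t.right := by
  cases t <;> simp_all [bottom, left, right, ofBottomFree]

@[simp] theorem top_ofTopFree (l r : Bool) : (ofTopFree l r).top = false := by
  cases l <;> cases r <;> rfl

@[simp] theorem bottom_ofTopFree (l r : Bool) : (ofTopFree l r).bottom = xor l r := by
  cases l <;> cases r <;> rfl

@[simp] theorem left_ofTopFree (l r : Bool) : (ofTopFree l r).left = l := by
  cases l <;> cases r <;> rfl

@[simp] theorem right_ofTopFree (l r : Bool) : (ofTopFree l r).right = r := by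
  cases l <;> cases r <;> rfl

@[simp] theorem top_ofBottomFree (l r : Bool) : (ofBottomFree l r).top = xor l r := by
  cases l <;> cases r <;> rfl

@[simp] theorem bottom_ofBottomFree (l r : Bool) : (ofBottomFree l r).bottom = false := by
  cases l <;> cases r <;> rfl

@[simp] theorem left_ofBottomFree (l r : Bool) : (ofBottomFree l r).left = l := by
  cases l <;> cases r <;> rfl

@[simp] theorem right_ofBottomFree (l r : Bool) : (ofBottomFree l r).right = r := by
  cases l <;> cases r <;> rfl

end Tile

/-- The state of the vertical edges to the right of column `j`, when `b` lists the states of the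
interior vertical edges. -/
def rightState {k : ℕ} (b : Fin k → Bool) (j : ℕ) : Bool :=
  if h : j < k then b ⟨j, h⟩ else false

/-- The state of the vertical edges to the left of column `j`, when `b` lists the states of the
interior vertical edges. -/
def leftState {k : ℕ} (b : Fin k → Bool) : ℕ → Bool
  | 0 => false
  | j + 1 => rightState b j

/-- The two-row mosaic whose interior vertical edges have states `b` in both rows. -/
def twoRowMosaic {k : ℕ} (b : Fin k → Bool) : Fin 2 → Fin (k + 1) → Tile :=
  ![fun j => .ofTopFree (leftState b j) (rightState b j),
    fun j => .ofBottomFree (leftState b j) (rightState b j)]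

theorem left_twoRowMosaic {k : ℕ} (b : Fin k → Bool) (i : Fin 2) (j : Fin (k + 1)) :
    (twoRowMosaic b i j).left = leftState b j := by
  fin_cases i <;> simp [twoRowMosaic]

theorem right_twoRowMosaic {k : ℕ} (b : Fin k → Bool) (i : Fin 2) (j : Fin (k + 1)) :
    (twoRowMosaic b i j).right = rightState b j := by
  fin_cases i <;> simp [twoRowMosaic]

theorem isKnotMosaic_twoRowMosaic {k : ℕ} (b : Fin k → Bool) : IsKnotMosaic (twoRowMosaic b) := by
  refine ⟨⟨fun i j h => ?_, fun i j h => ?_⟩, fun i j => ⟨fun h => ?_, fun h => ?_, fun h => ?_,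
    fun h => ?_⟩⟩
  · rw [left_twoRowMosaic, right_twoRowMosaic, leftState]
  · obtain rfl : i = 0 := by omega
    simp [twoRowMosaic]
  · obtain rfl : i = 0 := by omega
    simp [twoRowMosaic]
  · obtain rfl : i = 1 := by omega
    simp [twoRowMosaic]
  · rw [left_twoRowMosaic, h, leftState]
  · rw [right_twoRowMosaic, h]
    simp [rightState]

/-- In a knot mosaic with two rows, the vertical edges of the two rows agree. -/
theorem IsKnotMosaic.right_one_eq_right_zero {n : ℕ} {M : Fin 2 → Fin n → Tile}
    (hM : IsKnotMosaic M) (j : ℕ) (hj : j < n) : (M 1 ⟨j, hj⟩).right = (M 0 ⟨j, hj⟩).right := by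
  obtain ⟨⟨hrow, hcol⟩, hbd⟩ := hM
  have hstep (j : Fin n) (hleft : (M 1 j).left = (M 0 j).left) :
      (M 1 j).right = (M 0 j).right := by
    have hmid : (M 0 j).bottom = (M 1 j).top := hcol 0 j (by simp)
    rw [Tile.eq_ofTopFree ((hbd 0 j).1 rfl), Tile.eq_ofBottomFree ((hbd 1 j).2.1 rfl),
      hleft] at hmid
    simpa using hmid.symm
  induction j with
  | zero => exact hstep _ (by rw [(hbd 1 ⟨0, hj⟩).2.2.1 rfl, (hbd 0 ⟨0, hj⟩).2.2.1 rfl])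
  | succ j ih =>
    exact hstep _ (by rw [← hrow 1 ⟨j, by omega⟩ hj, ← hrow 0 ⟨j, by omega⟩ hj, ih])

theorem twoRowMosaic_right_zero {k : ℕ} {M : Fin 2 → Fin (k + 1) → Tile} (hM : IsKnotMosaic M) :
    twoRowMosaic (fun j => (M 0 j.castSucc).right) = M := by
  have hright (i : Fin 2) (j : Fin (k + 1)) :
      (M i j).right = rightState (fun j => (M 0 j.castSucc).right) j := by
    have hzero : (M i j).right = (M 0 j).right := by
      fin_cases i
      · rfl
      · exact hM.right_one_eq_right_zero j j.isLt
    rw [hzero, rightState]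
    split_ifs with h
    · rfl
    · exact (hM.2 0 j).2.2.2 (by omega)
  have hleft (i : Fin 2) (j : Fin (k + 1)) :
      (M i j).left = leftState (fun j => (M 0 j.castSucc).right) j := by
    obtain ⟨j, hj⟩ := j
    cases j with
    | zero => exact (hM.2 i _).2.2.1 rfl
    | succ j => rw [← hM.1.1 i ⟨j, by omega⟩ hj, hright]; rfl
  funext i j
  fin_cases i
  · change Tile.ofTopFree _ _ = M 0 j
    rw [← hleft 0, ← hright 0, ← Tile.eq_ofTopFree ((hM.2 0 j).1 rfl)]
  · change Tile.ofBottomFree _ _ = M 1 j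
    rw [← hleft 1, ← hright 1, ← Tile.eq_ofBottomFree ((hM.2 1 j).2.1 rfl)]

/-- Knot mosaics with two rows correspond to arbitrary states of the interior vertical edges. -/
def twoRowMosaicEquiv (k : ℕ) :
    {M : Fin 2 → Fin (k + 1) → Tile // IsKnotMosaic M} ≃ (Fin k → Bool) where
  toFun M j := (M.1 0 j.castSucc).right
  invFun b := ⟨twoRowMosaic b, isKnotMosaic_twoRowMosaic b⟩
  left_inv M := Subtype.ext (twoRowMosaic_right_zero M.2)
  right_inv b := by
    funext j
    simp [twoRowMosaic, rightState]

/-- For every integer `n ≥ 2`, `D_{2,n} = 2^{n-1}`. -/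
theorem knotMosaicCount_two (n : ℕ) (hn : 2 ≤ n) :
    knotMosaicCount 2 n = 2 ^ (n - 1) := by
  obtain ⟨k, rfl⟩ : ∃ k, n = k + 1 := ⟨n - 1, by omega⟩
  rw [knotMosaicCount, Nat.card_congr (twoRowMosaicEquiv k)]
  simp
end

section
/- For all integers m, n ≥ 3, the number of knot (m,n)-mosaics satisfies the lower bound 2^{(m-3)(n-3)} · 2(9·6^{m-2} + 1)(9·6^{n-2} + 1) ≤ 275 · D_{m,n}. -/
/-- The number of tiles whose four corners carry the given colours, an edge carrying a connection
point exactly when its two ends have different colours. -/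
def cornerWeight (a b c d : Bool) : ℕ := if a = d ∧ b = c ∧ a ≠ b then 4 else 1

/-- The tile `t` is compatible with the colours of its corners (top left, top right, bottom left,
bottom right). -/
def Tile.Fits (t : Tile) (a b c d : Bool) : Prop :=
  t.top = xor a b ∧ t.bottom = xor c d ∧ t.left = xor a c ∧ t.right = xor b d

instance (t : Tile) (a b c d : Bool) : Decidable (t.Fits a b c d) :=
  inferInstanceAs (Decidable (_ ∧ _))

theorem one_le_cornerWeight (a b c d : Bool) : 1 ≤ cornerWeight a b c d := by
  unfold cornerWeight; split <;> simp

theorem card_fits (a b c d : Bool) :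
    Fintype.card {t : Tile // t.Fits a b c d} = cornerWeight a b c d := by
  revert a b c d; decide

/-- A colouring of the inner grid points of a mosaic, extended by `false`. -/
def padColouring {p q : ℕ} (s : Fin p → Fin q → Bool) (i j : ℕ) : Bool :=
  if h : (0 < i ∧ i ≤ p) ∧ (0 < j ∧ j ≤ q) then s ⟨i - 1, by omega⟩ ⟨j - 1, by omega⟩ else false

theorem padColouring_succ {p q : ℕ} (s : Fin p → Fin q → Bool) (i : Fin p) (j : Fin q) :
    padColouring s (i + 1) (j + 1) = s i j := by
  have h : (0 < (i : ℕ) + 1 ∧ (i : ℕ) + 1 ≤ p) ∧ (0 < (j : ℕ) + 1 ∧ (j : ℕ) + 1 ≤ q) := by omega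
  simp [padColouring, h]

theorem padColouring_of_not {p q : ℕ} (s : Fin p → Fin q → Bool) {i j : ℕ}
    (h : ¬((0 < i ∧ i ≤ p) ∧ (0 < j ∧ j ≤ q))) : padColouring s i j = false :=
  dif_neg h

/-- Tile matrices compatible with a colouring of the inner grid points. -/
abbrev ColouredMosaic (p q : ℕ) : Type :=
  Σ s : Fin p → Fin q → Bool, ∀ (i : Fin (p + 1)) (j : Fin (q + 1)),
    {t : Tile // t.Fits (padColouring s i j) (padColouring s i (j + 1))
      (padColouring s (i + 1) j) (padColouring s (i + 1) (j + 1))}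

theorem ColouredMosaic.isKnotMosaic {p q : ℕ} (x : ColouredMosaic p q) :
    IsKnotMosaic fun i j => (x.2 i j : Tile) := by
  obtain ⟨s, f⟩ := x
  refine ⟨⟨fun i j h => ?_, fun i j h => ?_⟩, fun i j => ⟨fun h => ?_, fun h => ?_, fun h => ?_,
    fun h => ?_⟩⟩
  · exact (f i j).2.2.2.2.trans (f i ⟨j + 1, h⟩).2.2.2.1.symm
  · exact (f i j).2.2.1.trans (f ⟨i + 1, h⟩ j).2.1.symm
  · rw [(f i j).2.1, padColouring_of_not s (by omega), padColouring_of_not s (by omega)]; rfl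
  · rw [(f i j).2.2.1, padColouring_of_not s (by omega), padColouring_of_not s (by omega)]; rfl
  · rw [(f i j).2.2.2.1, padColouring_of_not s (by omega), padColouring_of_not s (by omega)]; rfl
  · rw [(f i j).2.2.2.2, padColouring_of_not s (by omega), padColouring_of_not s (by omega)]; rfl

theorem ColouredMosaic.injective_tiles (p q : ℕ) :
    Function.Injective fun (x : ColouredMosaic p q) i j => (x.2 i j : Tile) := by
  rintro ⟨s, f⟩ ⟨s', f'⟩ h
  have hf : ∀ i j, (f i j : Tile) = f' i j := fun i j => congrFun (congrFun h i) j
  have hpad : ∀ i < p + 1, ∀ j ≤ q + 1, padColouring s i j = padColouring s' i j := by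
    intro i hi j
    induction j with
    | zero =>
      intro _
      rw [padColouring_of_not s (by omega), padColouring_of_not s' (by omega)]
    | succ j ih =>
      intro hj
      have h₁ := (f ⟨i, hi⟩ ⟨j, by omega⟩).2.1
      have h₂ := (f' ⟨i, hi⟩ ⟨j, by omega⟩).2.1
      rw [hf, h₂] at h₁
      simpa [ih (by omega)] using h₁.symm
  obtain rfl : s = s' := by
    funext i j
    rw [← padColouring_succ s, ← padColouring_succ s']
    exact hpad _ (by omega) _ (by omega)
  congr 1
  funext i j
  exact Subtype.ext (hf i j)

/-- The weight of two consecutive rows of colours. -/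
def rowWeight {b : ℕ} (r r' : Fin (b + 1) → Bool) : ℕ :=
  ∏ j : Fin b, cornerWeight (r j.castSucc) (r j.succ) (r' j.castSucc) (r' j.succ)

theorem sum_rowWeight_le_knotMosaicCount (a b : ℕ) :
    ∑ s : Fin (a + 1) → Fin (b + 1) → Bool, ∏ i : Fin a, rowWeight (s i.castSucc) (s i.succ) ≤
      knotMosaicCount (a + 2) (b + 2) := by
  have hinj : Function.Injective (fun x : ColouredMosaic (a + 1) (b + 1) =>
      (⟨_, x.isKnotMosaic⟩ :
        {M : Fin (a + 2) → Fin (b + 2) → Tile // IsKnotMosaic M})) := fun x y h =>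
    ColouredMosaic.injective_tiles _ _ (congrArg Subtype.val h)
  refine le_trans ?_ (Nat.card_le_card_of_injective _ hinj)
  rw [Nat.card_eq_fintype_card, Fintype.card_sigma]
  refine Finset.sum_le_sum fun s _ => ?_
  simp only [Fintype.card_pi, card_fits]
  rw [Fin.prod_univ_succ]
  refine le_trans ?_ (Nat.le_mul_of_pos_left _ (Finset.prod_pos fun _ _ => one_le_cornerWeight ..))
  rw [Fin.prod_univ_castSucc]
  refine le_trans ?_ (Nat.le_mul_of_pos_right _ (Finset.prod_pos fun _ _ => one_le_cornerWeight ..))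
  refine Finset.prod_le_prod' fun i _ => ?_
  rw [Fin.prod_univ_succ]
  refine le_trans ?_ (Nat.le_mul_of_pos_left _ (one_le_cornerWeight ..))
  rw [Fin.prod_univ_castSucc]
  refine le_trans ?_ (Nat.le_mul_of_pos_right _ (one_le_cornerWeight ..))
  refine Finset.prod_le_prod' fun j _ => le_of_eq ?_
  rw [← padColouring_succ s i.castSucc j.castSucc, ← padColouring_succ s i.castSucc j.succ,
    ← padColouring_succ s i.succ j.castSucc, ← padColouring_succ s i.succ j.succ]
  simp

section Chain

variable {α : Type*} [Fintype α]

/-- The total weight of the chains of `k` steps from a given starting point. -/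
def chainSum (K : α → α → ℕ) : ℕ → α → ℕ
  | 0, _ => 1
  | k + 1, x => ∑ y, K x y * chainSum K k y

theorem sum_fin_succ_fun {k : ℕ} (F : (Fin (k + 1) → α) → ℕ) :
    ∑ s, F s = ∑ x, ∑ t : Fin k → α, F (Fin.cons x t) := by
  rw [← (Fin.consEquiv fun _ : Fin (k + 1) => α).sum_comp, Fintype.sum_prod_type]
  rfl

theorem sum_mul_prod_eq_chainSum (K : α → α → ℕ) (k : ℕ) (F : α → ℕ) :
    ∑ s : Fin (k + 1) → α, F (s 0) * ∏ i : Fin k, K (s i.castSucc) (s i.succ) =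
      ∑ x, F x * chainSum K k x := by
  induction k generalizing F with
  | zero => simp [sum_fin_succ_fun, chainSum]
  | succ k ih =>
    have h := ih fun y => ∑ x, F x * K x y
    rw [sum_fin_succ_fun, Finset.sum_comm]
    simp only [Fin.prod_univ_succ (n := k), ← Fin.succ_castSucc, Fin.castSucc_zero, Fin.cons_zero,
      Fin.cons_succ, chainSum, ← mul_assoc, ← Finset.sum_mul, Finset.mul_sum]
    rw [h, Finset.sum_comm]
    simp only [Finset.sum_mul]

end Chain

/-- The total weight of the colourings extending a strip of width two by `k` steps, given whether
the two colours at its end differ. -/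
def stripWeight : ℕ → Bool → ℕ
  | 0, _ => 1
  | k + 1, false => 2 * stripWeight k false + 2 * stripWeight k true
  | k + 1, true => 2 * stripWeight k false + 5 * stripWeight k true

theorem sum_cornerWeight_mul_stripWeight (k : ℕ) (x y : Bool) :
    ∑ z : Bool × Bool, cornerWeight x y z.1 z.2 * stripWeight k (xor z.1 z.2) =
      stripWeight (k + 1) (xor x y) := by
  cases x <;> cases y <;>
    simp [Fintype.sum_prod_type, cornerWeight, stripWeight] <;> ring

theorem cornerWeight_swap (a b c d : Bool) : cornerWeight a b c d = cornerWeight a c b d := by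
  revert a b c d; decide

theorem chainSum_strip (k : ℕ) (x : Bool × Bool) :
    chainSum (fun x y : Bool × Bool => cornerWeight x.1 y.1 x.2 y.2) k x =
      stripWeight k (xor x.1 x.2) := by
  induction k generalizing x with
  | zero => simp [chainSum, stripWeight]
  | succ k ih =>
    simp only [chainSum, ih]
    rw [← sum_cornerWeight_mul_stripWeight]
    exact Finset.sum_congr rfl fun z _ => by rw [cornerWeight_swap]

theorem cornerWeight_le_rowWeight {b : ℕ} (r r' : Fin (b + 2) → Bool) :
    cornerWeight (r 0) (r 1) (r' 0) (r' 1) ≤ rowWeight r r' := by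
  rw [rowWeight, Fin.prod_univ_succ]
  exact Nat.le_mul_of_pos_right _ (Finset.prod_pos fun _ _ => one_le_cornerWeight ..)

theorem stripWeight_le_chainSum {b : ℕ} (k : ℕ) (r : Fin (b + 2) → Bool) :
    2 ^ (k * b) * stripWeight k (xor (r 0) (r 1)) ≤ chainSum rowWeight k r := by
  induction k generalizing r with
  | zero => simp [chainSum, stripWeight]
  | succ k ih =>
    calc 2 ^ ((k + 1) * b) * stripWeight (k + 1) (xor (r 0) (r 1))
        = ∑ r' : Fin (b + 2) → Bool, cornerWeight (r 0) (r 1) (r' 0) (r' 1) *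
            (2 ^ (k * b) * stripWeight k (xor (r' 0) (r' 1))) := by
          rw [← sum_cornerWeight_mul_stripWeight, Fintype.sum_prod_type, sum_fin_succ_fun,
            Finset.mul_sum]
          refine Finset.sum_congr rfl fun x _ => ?_
          rw [sum_fin_succ_fun, Finset.mul_sum]
          refine Finset.sum_congr rfl fun y _ => ?_
          simp only [Fin.cons_zero, Fin.cons_one, Finset.sum_const, Finset.card_univ,
            Fintype.card_fun, Fintype.card_bool, Fintype.card_fin, smul_eq_mul]
          ring
      _ ≤ chainSum rowWeight (k + 1) r :=
          Finset.sum_le_sum fun r' _ => Nat.mul_le_mul (cornerWeight_le_rowWeight r r') (ih r')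

theorem sum_two_rows (b : ℕ) (g : Bool → ℕ) :
    ∑ r : Fin (b + 2) → Bool, ∑ r' : Fin (b + 2) → Bool,
      rowWeight r r' * g (xor (r' 0) (r' 1)) =
    4 * g false * stripWeight b false + 4 * g false * stripWeight b true +
      4 * g true * stripWeight b false + 10 * g true * stripWeight b true := by
  rw [← Fintype.sum_prod_type', ← (Equiv.arrowProdEquivProdArrow _ _ _).sum_comp,
    sum_fin_succ_fun, Finset.sum_comm]
  have h := sum_mul_prod_eq_chainSum (fun x y : Bool × Bool => cornerWeight x.1 y.1 x.2 y.2) b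
    fun y => ∑ x : Bool × Bool, cornerWeight x.1 y.1 x.2 y.2 * g (xor x.2 y.2)
  simp only [chainSum_strip] at h
  trans ∑ y : Bool × Bool, (∑ x : Bool × Bool, cornerWeight x.1 y.1 x.2 y.2 * g (xor x.2 y.2)) *
    stripWeight b (xor y.1 y.2)
  · rw [← h]
    refine Finset.sum_congr rfl fun t _ => ?_
    rw [Finset.sum_mul]
    refine Finset.sum_congr rfl fun x _ => ?_
    simp only [rowWeight, Fin.prod_univ_succ (n := b), ← Fin.succ_castSucc, Fin.castSucc_zero,
      Equiv.arrowProdEquivProdArrow_apply, Fin.cons_zero, Fin.cons_succ, Fin.cons_one]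
    ring
  · simp [Fintype.sum_prod_type, cornerWeight]
    ring

theorem stripWeight_closed_form (k : ℕ) :
    5 * stripWeight k false = 3 * 6 ^ k + 2 ∧ 5 * stripWeight k true + 1 = 6 * 6 ^ k := by
  induction k with
  | zero => simp [stripWeight]
  | succ k ih =>
    simp only [stripWeight, pow_succ]
    omega

theorem le_corner_sum (a b : ℕ) :
    2 * (9 * 6 ^ (a + 1) + 1) * (9 * 6 ^ (b + 1) + 1) ≤
      275 * (4 * stripWeight a false * stripWeight b false +
        4 * stripWeight a false * stripWeight b true +
        4 * stripWeight a true * stripWeight b false +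
        10 * stripWeight a true * stripWeight b true) := by
  obtain ⟨h₁, h₂⟩ := stripWeight_closed_form a
  obtain ⟨h₃, h₄⟩ := stripWeight_closed_form b
  have ha : 1 ≤ 6 ^ a := Nat.one_le_pow _ _ (by norm_num)
  have hb : 1 ≤ 6 ^ b := Nat.one_le_pow _ _ (by norm_num)
  rw [pow_succ, pow_succ]
  generalize stripWeight a false = x at *
  generalize stripWeight a true = y at *
  generalize stripWeight b false = z at *
  generalize stripWeight b true = w at *
  generalize 6 ^ a = A at *
  generalize 6 ^ b = B at *
  zify at *
  have hxz : 25 * ((x : ℤ) * z) = (3 * A + 2) * (3 * B + 2) := by rw [← h₁, ← h₃]; ring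
  have hxw : 25 * ((x : ℤ) * w) = (3 * A + 2) * (6 * B - 1) := by rw [← h₁, ← h₄]; ring
  have hyz : 25 * ((y : ℤ) * z) = (6 * A - 1) * (3 * B + 2) := by rw [← h₂, ← h₃]; ring
  have hyw : 25 * ((y : ℤ) * w) = (6 * A - 1) * (6 * B - 1) := by rw [← h₂, ← h₄]; ring
  have hAB : 0 ≤ ((A : ℤ) - 1) * (B - 1) := mul_nonneg (by linarith) (by linarith)
  linarith

/-- For all integers `m, n ≥ 3`,
`2^{(m-3)(n-3)} · 2(9·6^{m-2}+1)(9·6^{n-2}+1) ≤ 275 · D_{m,n}`. -/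
theorem knotMosaicCount_lower_bound (m n : ℕ) (hm : 3 ≤ m) (hn : 3 ≤ n) :
    2 ^ ((m - 3) * (n - 3)) * (2 * (9 * 6 ^ (m - 2) + 1) * (9 * 6 ^ (n - 2) + 1)) ≤
      275 * knotMosaicCount m n := by

  obtain ⟨a, rfl⟩ := Nat.exists_eq_add_of_le' hm
  obtain ⟨b, rfl⟩ := Nat.exists_eq_add_of_le' hn
  have hcount := sum_rowWeight_le_knotMosaicCount (a + 1) (b + 1)
  have hchain := sum_mul_prod_eq_chainSum (rowWeight (b := b + 1)) (a + 1) fun _ => 1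
  simp only [one_mul, chainSum] at hchain
  rw [hchain] at hcount
  have hlow : 2 ^ (a * b) * ∑ r : Fin (b + 2) → Bool, ∑ r' : Fin (b + 2) → Bool,
      rowWeight r r' * stripWeight a (xor (r' 0) (r' 1)) ≤ knotMosaicCount (a + 3) (b + 3) := by
    refine le_trans ?_ hcount
    simp only [Finset.mul_sum, mul_left_comm (2 ^ (a * b))]
    gcongr
    exact stripWeight_le_chainSum a _
  rw [sum_two_rows] at hlow
  calc _ ≤ 2 ^ (a * b) * (275 * _) := Nat.mul_le_mul_left _ (le_corner_sum a b)
    _ = 275 * (2 ^ (a * b) * _) := mul_left_comm ..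
    _ ≤ _ := Nat.mul_le_mul_left _ hlow
end

section
/- (Twofold rule) For all positive integers p and q, every (p,q)-quasimosaic Q can be extended to exactly two knot (p+2,q+2)-mosaics; that is, the number of knot (p+2,q+2)-mosaics whose central p×q submatrix (rows 2 through p+1 and columns 2 through q+1) equals Q is exactly 2. -/
/-- The tile whose corners, listed as top-left, top-right, bottom-left, bottom-right, carry the
given colours and whose edges carry a connection point exactly when their endpoints have
different colours. -/
def Tile.ofCorners : Bool → Bool → Bool → Bool → Tile
  | false, false, false, false | true, true, true, true => .T0
  | false, false, true, false | true, true, false, true => .T1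
  | false, false, false, true | true, true, true, false => .T2
  | false, true, false, false | true, false, true, true => .T3
  | true, false, false, false | false, true, true, true => .T4
  | false, false, true, true | true, true, false, false => .T5
  | false, true, false, true | true, false, true, false => .T6
  | true, false, false, true | false, true, true, false => .T7

/-- An edge of `t` carries a connection point exactly when its endpoints have different colours. -/
def Tile.IsColoredBy (t : Tile) (a b c d : Bool) : Prop :=
  t.top = (a ^^ b) ∧ t.bottom = (c ^^ d) ∧ t.left = (a ^^ c) ∧ t.right = (b ^^ d)

theorem Tile.isColoredBy_ofCorners (a b c d : Bool) :
    (Tile.ofCorners a b c d).IsColoredBy a b c d := by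
  unfold Tile.IsColoredBy
  revert a b c d
  decide

/-- A tile with a free edge is determined by the colours of its corners. -/
theorem Tile.IsColoredBy.eq_ofCorners {t : Tile} {a b c d : Bool} (h : t.IsColoredBy a b c d)
    (hfree : a = b ∨ c = d ∨ a = c ∨ b = d) : t = Tile.ofCorners a b c d := by
  unfold Tile.IsColoredBy at h
  revert a b c d
  cases t <;> decide

theorem Tile.bottom_eq_xor (t : Tile) : t.bottom = (t.top ^^ t.left ^^ t.right) := by
  cases t <;> rfl

/-- `c` colours the lattice points of the mosaic `M` so that an edge carries a connection point
exactly when its endpoints have different colours. -/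
def IsVertexColoring {m n : ℕ} (M : Fin m → Fin n → Tile) (c : ℕ → ℕ → Bool) : Prop :=
  ∀ (i : Fin m) (j : Fin n),
    (M i j).IsColoredBy (c i j) (c i (j + 1)) (c (i + 1) j) (c (i + 1) (j + 1))

theorem IsVertexColoring.suitablyConnected {m n : ℕ} {M : Fin m → Fin n → Tile}
    {c : ℕ → ℕ → Bool} (hc : IsVertexColoring M c) : SuitablyConnected M :=
  ⟨fun i j h => (hc i j).2.2.2.trans (hc i ⟨j + 1, h⟩).2.2.1.symm,
    fun i j h => (hc i j).2.1.trans (hc ⟨i + 1, h⟩ j).1.symm⟩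

theorem SuitablyConnected.exists_isVertexColoring {m n : ℕ} {M : Fin m → Fin n → Tile}
    (hM : SuitablyConnected M) : ∃ c, IsVertexColoring M c ∧ c 0 0 = false := by
  let H : ℕ → Bool := fun j =>
    if h : 0 < m ∧ j < n then (M ⟨0, h.1⟩ ⟨j, h.2⟩).top else false
  let V : ℕ → ℕ → Bool := fun i j =>
    if h : i < m ∧ j < n then (M ⟨i, h.1⟩ ⟨j, h.2⟩).left
    else if h : i < m ∧ 0 < n then (M ⟨i, h.1⟩ ⟨n - 1, by omega⟩).right else false
  obtain ⟨c, h0, hr, hs⟩ : ∃ c : ℕ → ℕ → Bool, c 0 0 = false ∧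
      (∀ j, c 0 (j + 1) = (c 0 j ^^ H j)) ∧ ∀ i j, c (i + 1) j = (c i j ^^ V i j) :=
    ⟨fun i j => Nat.rec (Nat.rec false (fun k x => x ^^ H k) j) (fun k x => x ^^ V k j) i,
      rfl, fun _ => rfl, fun _ _ => rfl⟩
  have hleft (i : Fin m) (j : Fin n) : V i j = (M i j).left := by simp [V]
  have hright (i : Fin m) (j : Fin n) : V i (j + 1) = (M i j).right := by
    by_cases h : (j : ℕ) + 1 < n
    · simp [V, h, hM.1 i j h]
    · have hj : (⟨n - 1, by omega⟩ : Fin n) = j := by ext; simp; omega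
      simp [V, h, hj, j.pos]
  have xor_swap (a b x y : Bool) : (a ^^ b ^^ x ^^ y) = ((a ^^ x) ^^ (b ^^ y)) := by
    revert a b x y
    decide
  have htop (i : ℕ) (hi : i < m) (j : Fin n) :
      (M ⟨i, hi⟩ j).top = (c i j ^^ c i (j + 1)) := by
    induction i with
    | zero => simp [hr, H, hi]
    | succ i ih =>
      have hi' : i < m := by omega
      have hb := hM.2 ⟨i, hi'⟩ j hi
      rw [Tile.bottom_eq_xor, ih hi', ← hleft, ← hright] at hb
      rw [← hb, hs, hs]
      exact xor_swap _ _ _ _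
  refine ⟨c, fun i j => ⟨htop i i.2 j, ?_, ?_, ?_⟩, h0⟩
  · rw [Tile.bottom_eq_xor, htop i i.2 j, ← hleft, ← hright, hs, hs]
    exact xor_swap _ _ _ _
  · rw [hs, hleft]; simp
  · rw [hs, hright]; simp

/-- Two vertex colourings of the same mosaic agree up to swapping the colours. -/
theorem IsVertexColoring.eq_xor {m n : ℕ} (hm : 0 < m) (hn : 0 < n)
    {M : Fin m → Fin n → Tile} {c d : ℕ → ℕ → Bool}
    (hc : IsVertexColoring M c) (hd : IsVertexColoring M d) {i j : ℕ} (hi : i ≤ m) (hj : j ≤ n) :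
    d i j = (c i j ^^ (c 0 0 ^^ d 0 0)) := by
  have xor_step {a b a' b' e : Bool} :
      (a ^^ b) = (a' ^^ b') → a' = (a ^^ e) → b' = (b ^^ e) := by
    revert a b a' b' e
    decide
  have hrow : ∀ j ≤ n, d 0 j = (c 0 j ^^ (c 0 0 ^^ d 0 0)) := by
    intro j hj
    induction j with
    | zero => simp
    | succ j ih =>
      have h := (hc ⟨0, hm⟩ ⟨j, hj⟩).1.symm.trans (hd ⟨0, hm⟩ ⟨j, hj⟩).1
      exact xor_step h (ih (by omega))
  have hstep (i : ℕ) (hi : i < m) : (c i j ^^ c (i + 1) j) = (d i j ^^ d (i + 1) j) := by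
    rcases j with _ | j
    · exact (hc ⟨i, hi⟩ ⟨0, hn⟩).2.2.1.symm.trans (hd ⟨i, hi⟩ ⟨0, hn⟩).2.2.1
    · exact (hc ⟨i, hi⟩ ⟨j, hj⟩).2.2.2.symm.trans (hd ⟨i, hi⟩ ⟨j, hj⟩).2.2.2
  induction i with
  | zero => exact hrow j hj
  | succ i ih =>
    exact xor_step (hstep i hi) (ih (by omega))

theorem IsVertexColoring.boundaryFree {m n : ℕ} {M : Fin m → Fin n → Tile}
    {c : ℕ → ℕ → Bool} (hc : IsVertexColoring M c)
    (hb : ∀ i j, i = 0 ∨ i = m ∨ j = 0 ∨ j = n → c i j = false) : BoundaryFree M := by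
  intro i j
  obtain ⟨ht, hbo, hl, hr⟩ := hc i j
  refine ⟨fun h => ?_, fun h => ?_, fun h => ?_, fun h => ?_⟩
  · rw [ht, hb, hb] <;> simp [h]
  · rw [hbo, hb, hb] <;> first | rfl | omega
  · rw [hl, hb, hb] <;> simp [h]
  · rw [hr, hb, hb] <;> first | rfl | omega

/-- A vertex colouring of a mosaic without boundary connection points is constant along the
boundary. -/
theorem IsVertexColoring.eq_false_of_boundary {m n : ℕ} (hm : 0 < m) (hn : 0 < n)
    {M : Fin m → Fin n → Tile} {c : ℕ → ℕ → Bool} (hc : IsVertexColoring M c)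
    (hM : BoundaryFree M) (h0 : c 0 0 = false) {i j : ℕ} (hi : i ≤ m) (hj : j ≤ n)
    (hb : i = 0 ∨ i = m ∨ j = 0 ∨ j = n) : c i j = false := by
  have htop : ∀ j ≤ n, c 0 j = false := by
    intro j hj
    induction j with
    | zero => exact h0
    | succ j ih =>
      have h := (hc ⟨0, hm⟩ ⟨j, hj⟩).1.symm.trans ((hM ⟨0, hm⟩ ⟨j, hj⟩).1 rfl)
      simpa [ih (by omega)] using h
  have hleft : ∀ i ≤ m, c i 0 = false := by
    intro i hi
    induction i with
    | zero => exact h0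
    | succ i ih =>
      have h := (hc ⟨i, hi⟩ ⟨0, hn⟩).2.2.1.symm.trans ((hM ⟨i, hi⟩ ⟨0, hn⟩).2.2.1 rfl)
      simpa [ih (by omega)] using h
  have hbot : ∀ j ≤ n, c m j = false := by
    intro j hj
    induction j with
    | zero => exact hleft m le_rfl
    | succ j ih =>
      have h := (hc ⟨m - 1, by omega⟩ ⟨j, hj⟩).2.1.symm.trans
        ((hM ⟨m - 1, by omega⟩ ⟨j, hj⟩).2.1 rfl)
      simpa [Nat.sub_add_cancel hm, ih (by omega)] using h
  have hright : ∀ i ≤ m, c i n = false := by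
    intro i hi
    induction i with
    | zero => exact htop n le_rfl
    | succ i ih =>
      have h := (hc ⟨i, hi⟩ ⟨n - 1, by omega⟩).2.2.2.symm.trans
        ((hM ⟨i, hi⟩ ⟨n - 1, by omega⟩).2.2.2 rfl)
      simpa [Nat.sub_add_cancel hn, ih (by omega)] using h
  rcases hb with rfl | rfl | rfl | rfl
  exacts [htop j hj, hbot j hj, hleft i hi, hright i hi]

/-- The colouring `c` of the lattice points of a `(p,q)`-mosaic, with its colours swapped when `b`
is true, surrounded by a ring of lattice points coloured `false`. -/
def surroundColoring (p q : ℕ) (c : ℕ → ℕ → Bool) (b : Bool) (i j : ℕ) : Bool :=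
  if (1 ≤ i ∧ i ≤ p + 1) ∧ (1 ≤ j ∧ j ≤ q + 1) then c (i - 1) (j - 1) ^^ b else false

/-- The mosaic `Q` surrounded by the ring of tiles prescribed by `surroundColoring`. -/
def surroundMosaic {p q : ℕ} (Q : Fin p → Fin q → Tile) (c : ℕ → ℕ → Bool) (b : Bool)
    (i : Fin (p + 2)) (j : Fin (q + 2)) : Tile :=
  if h : (1 ≤ (i : ℕ) ∧ (i : ℕ) ≤ p) ∧ (1 ≤ (j : ℕ) ∧ (j : ℕ) ≤ q) then
    Q ⟨i - 1, by omega⟩ ⟨j - 1, by omega⟩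
  else
    Tile.ofCorners (surroundColoring p q c b i j) (surroundColoring p q c b i (j + 1))
      (surroundColoring p q c b (i + 1) j) (surroundColoring p q c b (i + 1) (j + 1))

theorem surroundColoring_of_boundary (p q : ℕ) (c : ℕ → ℕ → Bool) (b : Bool) {i j : ℕ}
    (h : i = 0 ∨ i = p + 2 ∨ j = 0 ∨ j = q + 2) : surroundColoring p q c b i j = false :=
  if_neg (by omega)

theorem surroundColoring_succ (p q : ℕ) (c : ℕ → ℕ → Bool) (b : Bool) {i j : ℕ}
    (hi : i ≤ p) (hj : j ≤ q) : surroundColoring p q c b (i + 1) (j + 1) = (c i j ^^ b) := by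
  simp [surroundColoring, hi, hj]

theorem surroundMosaic_central {p q : ℕ} (Q : Fin p → Fin q → Tile) (c : ℕ → ℕ → Bool) (b : Bool)
    (i : Fin p) (j : Fin q) :
    surroundMosaic Q c b i.succ.castSucc j.succ.castSucc = Q i j := by
  have hi : (i : ℕ) + 1 ≤ p := i.2
  have hj : (j : ℕ) + 1 ≤ q := j.2
  simp [surroundMosaic, hi, hj]

theorem IsVertexColoring.surround {p q : ℕ} {Q : Fin p → Fin q → Tile} {c : ℕ → ℕ → Bool}
    (hc : IsVertexColoring Q c) (b : Bool) :
    IsVertexColoring (surroundMosaic Q c b) (surroundColoring p q c b) := by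
  intro i j
  unfold surroundMosaic
  split_ifs with h
  · obtain ⟨i, hi⟩ := i
    obtain ⟨j, hj⟩ := j
    obtain ⟨⟨hi1, hip⟩, hj1, hjq⟩ := h
    obtain ⟨i, rfl⟩ := Nat.exists_eq_add_of_le' hi1
    obtain ⟨j, rfl⟩ := Nat.exists_eq_add_of_le' hj1
    dsimp only at *
    rw [surroundColoring_succ p q c b (by omega) (by omega),
      surroundColoring_succ p q c b (by omega) (by omega),
      surroundColoring_succ p q c b (by omega) (by omega),
      surroundColoring_succ p q c b (by omega) (by omega)]
    have hcancel (x y : Bool) : ((x ^^ b) ^^ (y ^^ b)) = (x ^^ y) := by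
      revert b x y
      decide
    simpa only [Tile.IsColoredBy, hcancel, Nat.add_sub_cancel] using hc ⟨i, hip⟩ ⟨j, hjq⟩
  · exact Tile.isColoredBy_ofCorners _ _ _ _

theorem IsVertexColoring.isKnotMosaic_surround {p q : ℕ} {Q : Fin p → Fin q → Tile}
    {c : ℕ → ℕ → Bool} (hc : IsVertexColoring Q c) (b : Bool) :
    IsKnotMosaic (surroundMosaic Q c b) :=
  ⟨(hc.surround b).suitablyConnected,
    (hc.surround b).boundaryFree fun _ _ h => surroundColoring_of_boundary p q c b h⟩

theorem surroundMosaic_injective {p q : ℕ} (Q : Fin p → Fin q → Tile) (c : ℕ → ℕ → Bool) :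
    Function.Injective (surroundMosaic Q c) := by
  intro b b' h
  have h00 := congrArg Tile.bottom (congrFun (congrFun h 0) 0)
  have key (b : Bool) : (surroundMosaic Q c b 0 0).bottom = (c 0 0 ^^ b) := by
    have hs := surroundColoring_succ p q c b (Nat.zero_le _) (Nat.zero_le _)
    have h0 := surroundColoring_of_boundary p q c b (i := 1) (j := 0) (by simp)
    simp only [zero_add] at hs
    simp [surroundMosaic, (Tile.isColoredBy_ofCorners _ _ _ _).2.1, hs, h0]
  rw [key, key] at h00
  simpa using h00

/-- Every knot mosaic extending `Q` arises from surrounding `Q`. -/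
theorem IsKnotMosaic.exists_eq_surroundMosaic {p q : ℕ} (hp : 0 < p) (hq : 0 < q)
    {Q : Fin p → Fin q → Tile} {c : ℕ → ℕ → Bool} (hc : IsVertexColoring Q c)
    {M : Fin (p + 2) → Fin (q + 2) → Tile} (hM : IsKnotMosaic M)
    (hQ : ∀ (i : Fin p) (j : Fin q), M i.succ.castSucc j.succ.castSucc = Q i j) :
    ∃ b, surroundMosaic Q c b = M := by
  obtain ⟨d, hd, hd0⟩ := hM.1.exists_isVertexColoring
  have hdQ : IsVertexColoring Q fun i j => d (i + 1) (j + 1) := by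
    intro i j
    rw [← hQ]
    exact hd i.succ.castSucc j.succ.castSucc
  refine ⟨c 0 0 ^^ d 1 1, ?_⟩
  have hbd {i j : ℕ} (hi : i ≤ p + 2) (hj : j ≤ q + 2)
      (hb : i = 0 ∨ i = p + 2 ∨ j = 0 ∨ j = q + 2) : d i j = false :=
    hd.eq_false_of_boundary (by omega) (by omega) hM.2 hd0 hi hj hb
  have heq {i j : ℕ} (hi : i ≤ p + 2) (hj : j ≤ q + 2) :
      surroundColoring p q c (c 0 0 ^^ d 1 1) i j = d i j := by
    by_cases hb : i = 0 ∨ i = p + 2 ∨ j = 0 ∨ j = q + 2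
    · rw [surroundColoring_of_boundary p q c _ hb, hbd hi hj hb]
    · obtain ⟨i, rfl⟩ := Nat.exists_eq_add_of_le' (show 1 ≤ i by omega)
      obtain ⟨j, rfl⟩ := Nat.exists_eq_add_of_le' (show 1 ≤ j by omega)
      rw [surroundColoring_succ p q c _ (by omega) (by omega)]
      exact (hc.eq_xor hp hq hdQ (by omega) (by omega)).symm
  funext i j
  have hi := i.2
  have hj := j.2
  unfold surroundMosaic
  split_ifs with h
  · rw [← hQ]
    congr 1 <;> ext <;> simp <;> omega
  · rw [heq (by omega) (by omega), heq (by omega) (by omega), heq (by omega) (by omega),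
      heq (by omega) (by omega)]
    refine ((hd i j).eq_ofCorners ?_).symm
    rcases (show (i : ℕ) = 0 ∨ (i : ℕ) = p + 1 ∨ (j : ℕ) = 0 ∨ (j : ℕ) = q + 1 by omega) with
      h | h | h | h
    · exact .inl (by rw [hbd, hbd] <;> omega)
    · exact .inr (.inl (by rw [hbd, hbd] <;> omega))
    · exact .inr (.inr (.inl (by rw [hbd, hbd] <;> omega)))
    · exact .inr (.inr (.inr (by rw [hbd, hbd] <;> omega)))

/-- Twofold rule: for positive integers `p, q`, every `(p,q)`-quasimosaic `Q` can be
extended to exactly two knot `(p+2,q+2)`-mosaics; i.e. the number of knot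
`(p+2,q+2)`-mosaics whose central `p × q` submatrix (rows `2,…,p+1` and columns
`2,…,q+1`) equals `Q` is exactly `2`. -/
theorem twofold_rule (p q : ℕ) (hp : 0 < p) (hq : 0 < q)
    (Q : Fin p → Fin q → Tile) (hQ : SuitablyConnected Q) :
    Nat.card {M : Fin (p + 2) → Fin (q + 2) → Tile //
      IsKnotMosaic M ∧ ∀ (i : Fin p) (j : Fin q),
        M i.succ.castSucc j.succ.castSucc = Q i j} = 2 := by
  obtain ⟨c, hc, -⟩ := hQ.exists_isVertexColoring
  let f (b : Bool) : {M : Fin (p + 2) → Fin (q + 2) → Tile //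
      IsKnotMosaic M ∧ ∀ (i : Fin p) (j : Fin q), M i.succ.castSucc j.succ.castSucc = Q i j} :=
    ⟨surroundMosaic Q c b, hc.isKnotMosaic_surround b, surroundMosaic_central Q c b⟩
  have hf : Function.Bijective f := by
    refine ⟨fun b b' h => surroundMosaic_injective Q c (congrArg Subtype.val h), fun M => ?_⟩
    obtain ⟨b, hb⟩ := M.2.1.exists_eq_surroundMosaic hp hq hc M.2.2
    exact ⟨b, Subtype.ext hb⟩
  rw [← Nat.card_eq_of_bijective f hf]
  simp
end

section
/- The total number of (3,3)-quasimosaics is |Q^{(3,3)}| = 2091977. -/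
/-- Counting length-three paths by their middle vertex. -/
theorem card_path_three {A B C σ τ : Type*} [Fintype A] [Fintype B] [Fintype C]
    [DecidableEq σ] [DecidableEq τ] (f : A → σ) (g : B → σ) (g' : B → τ) (h : C → τ) :
    Nat.card {p : A × B × C // f p.1 = g p.2.1 ∧ g' p.2.1 = h p.2.2} =
      ∑ b, Fintype.card {a // f a = g b} * Fintype.card {c // g' b = h c} := by
  let e : {p : A × B × C // f p.1 = g p.2.1 ∧ g' p.2.1 = h p.2.2} ≃
      Σ b, {a // f a = g b} × {c // g' b = h c} :=
    { toFun p := ⟨p.1.2.1, ⟨p.1.1, p.2.1⟩, ⟨p.1.2.2, p.2.2⟩⟩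
      invFun q := ⟨(q.2.1.1, q.1, q.2.2.1), q.2.1.2, q.2.2.2⟩
      left_inv _ := rfl
      right_inv _ := rfl }
  rw [Nat.card_congr e, Nat.card_eq_fintype_card, Fintype.card_sigma]
  simp only [Fintype.card_prod]

/-- A suitably connected row of three tiles. -/
abbrev ConnectedRow : Type :=
  {r : Tile × Tile × Tile // r.1.right = r.2.1.left ∧ r.2.1.right = r.2.2.left}

namespace ConnectedRow

/-- The connection points on the top edges of a row. -/
def tops (r : ConnectedRow) : Bool × Bool × Bool := (r.1.1.top, r.1.2.1.top, r.1.2.2.top)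

/-- The connection points on the bottom edges of a row. -/
def bottoms (r : ConnectedRow) : Bool × Bool × Bool :=
  (r.1.1.bottom, r.1.2.1.bottom, r.1.2.2.bottom)

/-- The number of connected rows with prescribed connection points along one side. -/
def countWithSide (s : Bool × Bool × Bool) : ℕ :=
  (4 + 3 * s.1.toNat) * (4 + 3 * s.2.2.toNat) +
    3 * s.2.1.toNat * (2 + 3 * s.1.toNat) * (2 + 3 * s.2.2.toNat)

theorem card_bottoms_eq (s : Bool × Bool × Bool) :
    Fintype.card {r : ConnectedRow // r.bottoms = s} = countWithSide s := by
  revert s; decide +kernel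

theorem card_eq_tops (s : Bool × Bool × Bool) :
    Fintype.card {r : ConnectedRow // s = r.tops} = countWithSide s := by
  revert s; decide +kernel

theorem sum_countWithSide :
    ∑ r : ConnectedRow, countWithSide r.tops * countWithSide r.bottoms = 2091977 := by
  decide +kernel

end ConnectedRow

theorem suitablyConnected_three_three_iff (M : Fin 3 → Fin 3 → Tile) :
    SuitablyConnected M ↔
      (∀ i, (M i 0).right = (M i 1).left ∧ (M i 1).right = (M i 2).left) ∧
      (∀ j, (M 0 j).bottom = (M 1 j).top ∧ (M 1 j).bottom = (M 2 j).top) := by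
  constructor
  · rintro ⟨h, v⟩
    exact ⟨fun i => ⟨h i 0 (by decide), h i 1 (by decide)⟩,
      fun j => ⟨v 0 j (by decide), v 1 j (by decide)⟩⟩
  · rintro ⟨h, v⟩
    refine ⟨fun i j hj => ?_, fun i j hi => ?_⟩
    · fin_cases j
      exacts [(h i).1, (h i).2, absurd hj (by decide)]
    · fin_cases i
      exacts [(v j).1, (v j).2, absurd hi (by decide)]

/-- A `(3,3)`-quasimosaic is a stack of three connected rows with matching sides. -/
def quasimosaicEquivRows :
    {M : Fin 3 → Fin 3 → Tile // SuitablyConnected M} ≃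
      {p : ConnectedRow × ConnectedRow × ConnectedRow //
        p.1.bottoms = p.2.1.tops ∧ p.2.1.bottoms = p.2.2.tops} where
  toFun M :=
    have h := (suitablyConnected_three_three_iff M.1).1 M.2
    ⟨(⟨(M.1 0 0, M.1 0 1, M.1 0 2), h.1 0⟩, ⟨(M.1 1 0, M.1 1 1, M.1 1 2), h.1 1⟩,
      ⟨(M.1 2 0, M.1 2 1, M.1 2 2), h.1 2⟩), by
      simp [ConnectedRow.tops, ConnectedRow.bottoms, h.2]⟩
  invFun p :=
    ⟨![![p.1.1.1.1, p.1.1.1.2.1, p.1.1.1.2.2], ![p.1.2.1.1.1, p.1.2.1.1.2.1, p.1.2.1.1.2.2],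
      ![p.1.2.2.1.1, p.1.2.2.1.2.1, p.1.2.2.1.2.2]], by
      obtain ⟨⟨⟨_, h₀⟩, ⟨_, h₁⟩, ⟨_, h₂⟩⟩, hv⟩ := p
      simp only [ConnectedRow.tops, ConnectedRow.bottoms, Prod.mk.injEq] at hv
      simp [suitablyConnected_three_three_iff, Fin.forall_fin_succ, h₀, h₁, h₂, hv]⟩
  left_inv M := by
    ext i j
    fin_cases i <;> fin_cases j <;> rfl
  right_inv _ := rfl

/-- The total number of `(3,3)`-quasimosaics is `|Q^{(3,3)}| = 2091977`. -/
theorem quasimosaicCount_three_three : quasimosaicCount 3 3 = 2091977 := by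
  rw [quasimosaicCount, Nat.card_congr quasimosaicEquivRows, card_path_three]
  simp only [ConnectedRow.card_bottoms_eq, ConnectedRow.card_eq_tops]
  exact ConnectedRow.sum_countWithSide
end

section
/- The number of (3,3)-quasimosaics in which none of the four edges of the center tile carries a connection point is 11^4 = 14641. -/
namespace Tile

instance inst_s17 : Fintype Tile where
  elems := {T0, T1, T2, T3, T4, T5, T6, T7, T8, T9, T10}
  complete t := by cases t <;> decide

theorem card_eq : Nat.card Tile = 11 := by
  rw [Nat.card_eq_fintype_card]
  rfl

/-- A tile without a connection point on its bottom edge is determined by its left and right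
edges, which may be prescribed freely. -/
theorem existsUnique_of_bottom : ∀ l r : Bool,
    ∃! t : Tile, t.bottom = false ∧ t.left = l ∧ t.right = r := by
  unfold ExistsUnique
  decide

/-- A tile without a connection point on its top edge is determined by its left and right
edges, which may be prescribed freely. -/
theorem existsUnique_of_top : ∀ l r : Bool,
    ∃! t : Tile, t.top = false ∧ t.left = l ∧ t.right = r := by
  unfold ExistsUnique
  decide

/-- A tile without a connection point on its right edge is determined by its top and bottom
edges, which may be prescribed freely. -/
theorem existsUnique_of_right : ∀ u d : Bool,
    ∃! t : Tile, t.right = false ∧ t.top = u ∧ t.bottom = d := by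
  unfold ExistsUnique
  decide

/-- A tile without a connection point on its left edge is determined by its top and bottom
edges, which may be prescribed freely. -/
theorem existsUnique_of_left : ∀ u d : Bool,
    ∃! t : Tile, t.left = false ∧ t.top = u ∧ t.bottom = d := by
  unfold ExistsUnique
  decide

theorem eq_T0 : ∀ t : Tile, t.top = false → t.bottom = false → t.left = false → t = T0 := by
  decide

end Tile

theorem suitablyConnected_three_iff (M : Fin 3 → Fin 3 → Tile) :
    SuitablyConnected M ↔
      (((M 0 0).right = (M 0 1).left ∧ (M 0 1).right = (M 0 2).left) ∧
        ((M 1 0).right = (M 1 1).left ∧ (M 1 1).right = (M 1 2).left) ∧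
        ((M 2 0).right = (M 2 1).left ∧ (M 2 1).right = (M 2 2).left)) ∧
      (((M 0 0).bottom = (M 1 0).top ∧ (M 1 0).bottom = (M 2 0).top) ∧
        ((M 0 1).bottom = (M 1 1).top ∧ (M 1 1).bottom = (M 2 1).top) ∧
        ((M 0 2).bottom = (M 1 2).top ∧ (M 1 2).bottom = (M 2 2).top)) := by
  constructor
  · rintro ⟨h, v⟩
    exact ⟨⟨⟨h 0 0 (by decide), h 0 1 (by decide)⟩, ⟨h 1 0 (by decide), h 1 1 (by decide)⟩,
        ⟨h 2 0 (by decide), h 2 1 (by decide)⟩⟩,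
      ⟨⟨v 0 0 (by decide), v 1 0 (by decide)⟩, ⟨v 0 1 (by decide), v 1 1 (by decide)⟩,
        ⟨v 0 2 (by decide), v 1 2 (by decide)⟩⟩⟩
  · rintro ⟨⟨⟨h00, h01⟩, ⟨h10, h11⟩, h20, h21⟩, ⟨v00, v10⟩, ⟨v01, v11⟩, v02, v12⟩
    constructor
    · intro i j h
      fin_cases i <;> fin_cases j <;> first | assumption | exact absurd h (by decide)
    · intro i j h
      fin_cases i <;> fin_cases j <;> first | assumption | exact absurd h (by decide)

/-- A `(3,3)`-quasimosaic with empty center is determined by its corner tiles, which may be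
prescribed freely. -/
theorem bijective_corners :
    Function.Bijective
      (fun M : {M : Fin 3 → Fin 3 → Tile // SuitablyConnected M ∧
          (M 1 1).top = false ∧ (M 1 1).bottom = false ∧
          (M 1 1).left = false ∧ (M 1 1).right = false} ↦
        (M.1 0 0, M.1 0 2, M.1 2 0, M.1 2 2)) := by
  constructor
  · rintro ⟨M, hM, mt, mb, ml, mr⟩ ⟨N, hN, nt, nb, nl, nr⟩ h
    rw [suitablyConnected_three_iff] at hM hN
    obtain ⟨⟨⟨a1, a2⟩, ⟨a3, a4⟩, a5, a6⟩, ⟨b1, b2⟩, ⟨b3, b4⟩, b5, b6⟩ := hM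
    obtain ⟨⟨⟨c1, c2⟩, ⟨c3, c4⟩, c5, c6⟩, ⟨d1, d2⟩, ⟨d3, d4⟩, d5, d6⟩ := hN
    simp only [Prod.mk.injEq] at h
    obtain ⟨e00, e02, e20, e22⟩ := h
    have e11 : M 1 1 = N 1 1 := by
      rw [Tile.eq_T0 _ mt mb ml, Tile.eq_T0 _ nt nb nl]
    have e01 : M 0 1 = N 0 1 :=
      (Tile.existsUnique_of_bottom (M 0 0).right (M 0 2).left).unique
        ⟨b3.trans mt, a1.symm, a2⟩ ⟨d3.trans nt, by rw [e00, c1], by rw [e02, c2]⟩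
    have e21 : M 2 1 = N 2 1 :=
      (Tile.existsUnique_of_top (M 2 0).right (M 2 2).left).unique
        ⟨b4.symm.trans mb, a5.symm, a6⟩ ⟨d4.symm.trans nb, by rw [e20, c5], by rw [e22, c6]⟩
    have e10 : M 1 0 = N 1 0 :=
      (Tile.existsUnique_of_right (M 0 0).bottom (M 2 0).top).unique
        ⟨a3.trans ml, b1.symm, b2⟩ ⟨c3.trans nl, by rw [e00, d1], by rw [e20, d2]⟩
    have e12 : M 1 2 = N 1 2 :=
      (Tile.existsUnique_of_left (M 0 2).bottom (M 2 2).top).unique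
        ⟨a4.symm.trans mr, b5.symm, b6⟩ ⟨c4.symm.trans nr, by rw [e02, d5], by rw [e22, d6]⟩
    ext i j
    fin_cases i <;> fin_cases j <;> assumption
  · rintro ⟨a, b, c, d⟩
    obtain ⟨t, ⟨t1, t2, t3⟩, -⟩ := Tile.existsUnique_of_bottom a.right b.left
    obtain ⟨u, ⟨u1, u2, u3⟩, -⟩ := Tile.existsUnique_of_top c.right d.left
    obtain ⟨l, ⟨l1, l2, l3⟩, -⟩ := Tile.existsUnique_of_right a.bottom c.top
    obtain ⟨r, ⟨r1, r2, r3⟩, -⟩ := Tile.existsUnique_of_left b.bottom d.top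
    exact ⟨⟨![![a, t, b], ![l, Tile.T0, r], ![c, u, d]],
      (suitablyConnected_three_iff _).2
        ⟨⟨⟨t2.symm, t3⟩, ⟨l1, r1.symm⟩, u2.symm, u3⟩, ⟨l2.symm, l3⟩, ⟨t1, u1.symm⟩, r2.symm, r3⟩,
      rfl, rfl, rfl, rfl⟩, rfl⟩

/-- The number of `(3,3)`-quasimosaics in which none of the four edges of the center
tile carries a connection point is `11⁴ = 14641`. -/
theorem quasimosaic_center_free_count :
    Nat.card {M : Fin 3 → Fin 3 → Tile // SuitablyConnected M ∧
      (M 1 1).top = false ∧ (M 1 1).bottom = false ∧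
      (M 1 1).left = false ∧ (M 1 1).right = false} = 11 ^ 4 := by
  rw [Nat.card_congr (Equiv.ofBijective _ bijective_corners)]
  simp only [Nat.card_prod, Tile.card_eq]
  norm_num
end

section
/- The total number of (2,3)-quasimosaics is |Q^{(2,3)}| = 27113. -/
instance inst_s19 : Fintype Tile where
  elems := {.T0, .T1, .T2, .T3, .T4, .T5, .T6, .T7, .T8, .T9, .T10}
  complete := by rintro ⟨⟩ <;> decide

/-- A vertically connected pair of tiles, the upper one first. -/
abbrev TileColumn : Type := {c : Tile × Tile // c.1.bottom = c.2.top}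

namespace TileColumn

/-- The connection data on the left side of a column. -/
def left (c : TileColumn) : Bool × Bool := (c.1.1.left, c.1.2.left)

/-- The connection data on the right side of a column. -/
def right (c : TileColumn) : Bool × Bool := (c.1.1.right, c.1.2.right)

end TileColumn

theorem suitablyConnected_two_three_iff (M : Fin 2 → Fin 3 → Tile) :
    SuitablyConnected M ↔
      (∀ j, (M 0 j).bottom = (M 1 j).top) ∧
      (∀ i, (M i 0).right = (M i 1).left) ∧ (∀ i, (M i 1).right = (M i 2).left) := by
  constructor
  · rintro ⟨h, v⟩
    exact ⟨fun j => v 0 j (by decide), fun i => h i 0 (by decide), fun i => h i 1 (by decide)⟩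
  · rintro ⟨v, h₀, h₁⟩
    refine ⟨fun i j hj => ?_, fun i j hi => ?_⟩
    · fin_cases j
      · exact h₀ i
      · exact h₁ i
      · exact absurd hj (by decide)
    · fin_cases i
      · exact v j
      · exact absurd hi (by decide)

/-- A `(2,3)`-quasimosaic amounts to a middle column together with a left neighbour and a right
neighbour that fit it. -/
def quasimosaicTwoThreeEquiv :
    {M : Fin 2 → Fin 3 → Tile // SuitablyConnected M} ≃
      Σ c : TileColumn,
        {a : TileColumn // a.right = c.left} × {b : TileColumn // b.left = c.right} where
  toFun M :=
    have h := (suitablyConnected_two_three_iff M.1).1 M.2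
    ⟨⟨(M.1 0 1, M.1 1 1), h.1 1⟩,
      ⟨⟨(M.1 0 0, M.1 1 0), h.1 0⟩, Prod.ext (h.2.1 0) (h.2.1 1)⟩,
      ⟨⟨(M.1 0 2, M.1 1 2), h.1 2⟩, Prod.ext (h.2.2 0).symm (h.2.2 1).symm⟩⟩
  invFun x :=
    ⟨![![x.2.1.1.1.1, x.1.1.1, x.2.2.1.1.1], ![x.2.1.1.1.2, x.1.1.2, x.2.2.1.1.2]], by
      obtain ⟨c, ⟨a, ha⟩, ⟨b, hb⟩⟩ := x
      rw [suitablyConnected_two_three_iff]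
      obtain ⟨ha₀, ha₁⟩ := Prod.ext_iff.1 ha
      obtain ⟨hb₀, hb₁⟩ := Prod.ext_iff.1 hb
      refine ⟨fun j => ?_, fun i => ?_, fun i => ?_⟩
      · fin_cases j
        exacts [a.2, c.2, b.2]
      · fin_cases i
        exacts [ha₀, ha₁]
      · fin_cases i
        exacts [hb₀.symm, hb₁.symm]⟩
  left_inv M := by
    ext i j
    fin_cases i <;> fin_cases j <;> rfl
  right_inv _ := rfl

/-- The total number of `(2,3)`-quasimosaics is `|Q^{(2,3)}| = 27113`. -/
theorem quasimosaicCount_two_three : quasimosaicCount 2 3 = 27113 := by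
  rw [quasimosaicCount, Nat.card_congr quasimosaicTwoThreeEquiv, Nat.card_eq_fintype_card,
    Fintype.card_sigma]
  simp only [Fintype.card_prod]
  decide +kernel
end
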